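/- arXiv:2305.14000 — 4 statements merged into one kernel-verified Lean document; each statement's English description precedes it below -/
import Mathlib

section
/- Let u be a vertex and τ > 0 with τ * Real.sqrt (dmin * d u) < S, where dmin is the minimum degree (dmin := ⨅ v, d v, positive). Define ℓu := ⌈Real.logb λ (τ * Real.sqrt (dmin * d u) / S)⌉₊ (a natural number, since 0 < λ < 1 and the argument of the logarithm lies in (0,1)). Then ℓu is τ-distance of u: for every vertex v, |(P ^ ℓu) u v − π v| ≤ τ * π v. -/
open Finset

theorem tau_distance_of_ceil_logb
    {V : Type*} [Fintype V] [Nonempty V] [DecidableEq V]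
    (A : Matrix V V ℝ) (hsym : A.IsSymm) (hnn : ∀ u v, 0 ≤ A u v)
    (d : V → ℝ) (hd : ∀ u, d u = ∑ v, A u v) (hdpos : ∀ u, 0 < d u)
    (S : ℝ) (hS : S = ∑ u, d u)
    (P : Matrix V V ℝ) (hP : ∀ u v, P u v = A u v / d u)
    (Ptil : Matrix V V ℝ)
    (hPtil : ∀ u v, Ptil u v = A u v / (Real.sqrt (d u) * Real.sqrt (d v)))
    (π : V → ℝ) (hπ : ∀ v, π v = d v / S)
    (lam : ℝ) (hlam0 : 0 < lam) (hlam1 : lam < 1)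
    (hgap : ∀ x : V → ℝ, (∑ v, x v * Real.sqrt (d v)) = 0 →
      Real.sqrt (∑ v, (Ptil.mulVec x v) ^ 2) ≤ lam * Real.sqrt (∑ v, (x v) ^ 2))
    (u : V) (τ : ℝ) (hτ : 0 < τ)
    (dmin : ℝ) (hdmin : dmin = ⨅ v, d v)
    (hsmall : τ * Real.sqrt (dmin * d u) < S)
    (ℓu : ℕ) (hℓu : ℓu = ⌈Real.logb lam (τ * Real.sqrt (dmin * d u) / S)⌉₊) :
    ∀ v, |(P ^ ℓu) u v - π v| ≤ τ * π v := by
  have hs : ∀ v, 0 < Real.sqrt (d v) := fun v => Real.sqrt_pos.2 (hdpos v)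
  have hss : ∀ v, Real.sqrt (d v) * Real.sqrt (d v) = d v :=
    fun v => Real.mul_self_sqrt (hdpos v).le
  have hSpos : 0 < S := by
    rw [hS]; exact Finset.sum_pos (fun v _ => hdpos v) Finset.univ_nonempty
  have hrow : ∀ l : ℕ, ∑ v, (P ^ l) u v = 1 := by
    intro l
    induction l with
    | zero => simp [Matrix.one_apply]
    | succ l ih =>
      simp only [pow_succ, Matrix.mul_apply]
      rw [Finset.sum_comm, ← ih]
      refine Finset.sum_congr rfl fun w _ => ?_
      rw [← Finset.mul_sum]
      have : ∑ v, P w v = 1 := by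
        simp only [hP]
        rw [← Finset.sum_div, ← hd, div_self (hdpos w).ne']
      rw [this, mul_one]
  have hsumd : ∑ v, d v / S = 1 := by
    rw [← Finset.sum_div, ← hS, div_self hSpos.ne']
  let y : ℕ → V → ℝ := fun l v => ((P ^ l) u v - d v / S) * (Real.sqrt (d u) / Real.sqrt (d v))
  have horth : ∀ l, ∑ v, y l v * Real.sqrt (d v) = 0 := by
    intro l
    have : ∀ v, y l v * Real.sqrt (d v) = ((P ^ l) u v - d v / S) * Real.sqrt (d u) := by
      intro v
      have := (hs v).ne'
      simp only [y]
      field_simp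
    simp only [this]
    rw [← Finset.sum_mul, Finset.sum_sub_distrib, hrow, hsumd]
    simp
  have hstep : ∀ l, Ptil.mulVec (y l) = y (l + 1) := by
    intro l
    ext v
    simp only [y, Matrix.mulVec, dotProduct, pow_succ, Matrix.mul_apply, hP, hPtil]
    have e : ∑ w, A w v / S = d v / S := by
      rw [← Finset.sum_div, hd]
      congr 1
      exact Finset.sum_congr rfl fun w _ => hsym.apply v w
    rw [← e, ← Finset.sum_sub_distrib, Finset.sum_mul]
    refine Finset.sum_congr rfl fun w _ => ?_
    have h1 := (hs v).ne'
    have h2 := (hs w).ne'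
    rw [hsym.apply w v, ← hss w]
    field_simp
    rw [Real.sqrt_sq (hs w).le]
  have hnorm : ∀ l, Real.sqrt (∑ v, (y l v) ^ 2) ≤ lam ^ l := by
    intro l
    induction l with
    | zero =>
      rw [pow_zero, Real.sqrt_le_one]
      have e : ∀ v, (y 0 v) ^ 2 = (if u = v then 1 - 2 * d u / S else 0) + d v / S * (d u / S) := by
        intro v
        have h1 := (hdpos v).ne'
        simp only [y, pow_zero, Matrix.one_apply, mul_pow, div_pow,
          Real.sq_sqrt (hdpos _).le]
        split_ifs with h
        · subst h
          field_simp
          ring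
        · field_simp
          ring
      simp only [e]
      rw [Finset.sum_add_distrib, ← Finset.sum_mul, hsumd]
      simp only [Finset.sum_ite_eq, Finset.mem_univ, if_true]
      have : 0 < d u / S := div_pos (hdpos u) hSpos
      rw [mul_div_assoc]
      linarith
    | succ l ih =>
      have h := hgap (y l) (horth l)
      rw [hstep] at h
      rw [pow_succ']
      exact h.trans (mul_le_mul_of_nonneg_left ih hlam0.le)
  have hdle : ∀ v, dmin ≤ d v := fun v => by
    rw [hdmin]; exact ciInf_le (Set.finite_range d).bddBelow v
  have hdm : 0 < dmin := by
    obtain ⟨w, hw⟩ := exists_eq_ciInf_of_finite (f := d)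
    rw [hdmin, ← hw]; exact hdpos w
  have hargpos : 0 < τ * Real.sqrt (dmin * d u) / S :=
    div_pos (mul_pos hτ (Real.sqrt_pos.2 (mul_pos hdm (hdpos u)))) hSpos
  have hpow : lam ^ ℓu ≤ τ * Real.sqrt (dmin * d u) / S := by
    have h : Real.logb lam (τ * Real.sqrt (dmin * d u) / S) ≤ ℓu := by
      rw [hℓu]; exact Nat.le_ceil _
    rw [Real.logb_le_iff_le_rpow_of_base_lt_one hlam0 hlam1 hargpos, Real.rpow_natCast] at h
    exact h
  intro v
  have hy : |y ℓu v| ≤ τ * Real.sqrt (dmin * d u) / S := by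
    refine le_trans ?_ ((hnorm ℓu).trans hpow)
    apply Real.abs_le_sqrt
    exact Finset.single_le_sum (f := fun v => (y ℓu v) ^ 2) (fun _ _ => sq_nonneg _)
      (Finset.mem_univ v)
  have hr : 0 < Real.sqrt (d v) / Real.sqrt (d u) := div_pos (hs v) (hs u)
  have e : (P ^ ℓu) u v - π v = y ℓu v * (Real.sqrt (d v) / Real.sqrt (d u)) := by
    have h1 := (hs v).ne'
    have h2 := (hs u).ne'
    simp only [y, hπ]
    field_simp
  rw [e, abs_mul, abs_of_pos hr, hπ]
  refine (mul_le_mul_of_nonneg_right hy hr.le).trans ?_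
  have e2 : τ * Real.sqrt (dmin * d u) / S * (Real.sqrt (d v) / Real.sqrt (d u))
      = τ * ((Real.sqrt dmin * Real.sqrt (d v)) / S) := by
    have h2 := (hs u).ne'
    rw [Real.sqrt_mul hdm.le]
    field_simp
  rw [e2]
  apply mul_le_mul_of_nonneg_left _ hτ.le
  apply div_le_div_of_nonneg_right _ hSpos.le
  calc _ ≤ Real.sqrt (d v) * Real.sqrt (d v) :=
        mul_le_mul_of_nonneg_right (Real.sqrt_le_sqrt (hdle v)) (hs v).le
    _ = d v := hss v
end

section
/- For all vertices u, v and every ℓ : ℕ, |(P ^ ℓ) u v − π v| / π v ≤ S * λ ^ ℓ / Real.sqrt (d u * d v); equivalently, |(P ^ ℓ) u v − π v| ≤ λ ^ ℓ * Real.sqrt (d v) / Real.sqrt (d u). -/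
open Finset

theorem transition_power_convergence_bound
    {V : Type*} [Fintype V] [Nonempty V] [DecidableEq V]
    (A : Matrix V V ℝ) (hsym : A.IsSymm) (hnn : ∀ u v, 0 ≤ A u v)
    (d : V → ℝ) (hd : ∀ u, d u = ∑ v, A u v) (hdpos : ∀ u, 0 < d u)
    (S : ℝ) (hS : S = ∑ u, d u)
    (P : Matrix V V ℝ) (hP : ∀ u v, P u v = A u v / d u)
    (Ptil : Matrix V V ℝ)
    (hPtil : ∀ u v, Ptil u v = A u v / (Real.sqrt (d u) * Real.sqrt (d v)))
    (π : V → ℝ) (hπ : ∀ v, π v = d v / S)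
    (lam : ℝ) (hlam0 : 0 ≤ lam) (hlam1 : lam ≤ 1)
    (hgap : ∀ x : V → ℝ, (∑ v, x v * Real.sqrt (d v)) = 0 →
      Real.sqrt (∑ v, (Ptil.mulVec x v) ^ 2) ≤ lam * Real.sqrt (∑ v, (x v) ^ 2)) :
    ∀ (u v : V) (ℓ : ℕ),
      |(P ^ ℓ) u v - π v| / π v ≤ S * lam ^ ℓ / Real.sqrt (d u * d v) ∧
      |(P ^ ℓ) u v - π v| ≤ lam ^ ℓ * Real.sqrt (d v) / Real.sqrt (d u) := by
  intro u v ℓ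
  have hsp : ∀ u, 0 < Real.sqrt (d u) := fun u => Real.sqrt_pos.2 (hdpos u)
  have hss : ∀ u, Real.sqrt (d u) * Real.sqrt (d u) = d u :=
    fun u => Real.mul_self_sqrt (hdpos u).le
  have hSpos : 0 < S := by
    rw [hS]; exact Finset.sum_pos (fun i _ => hdpos i) Finset.univ_nonempty
  have hpv : 0 < π v := by rw [hπ]; exact div_pos (hdpos v) hSpos
  have hrow : ∀ u, ∑ w, P u w = 1 := by
    intro u
    simp only [hP]
    rw [← Finset.sum_div, ← hd, div_self (hdpos u).ne']
  have hcol : ∀ w, ∑ u, d u * P u w = d w := by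
    intro w
    rw [hd w]
    refine Finset.sum_congr rfl fun u _ => ?_
    rw [hP, mul_div_cancel₀ _ (hdpos u).ne', hsym.apply]
  have hstep : ∀ (k : ℕ) (u : V), ((P ^ (k+1)) u v - π v) = ∑ w, P u w * ((P ^ k) w v - π v) := by
    intro k u
    simp only [mul_sub, Finset.sum_sub_distrib]
    rw [← Finset.sum_mul, hrow, one_mul, pow_succ', Matrix.mul_apply]
  have horth : ∀ k : ℕ, ∑ u, d u * ((P ^ k) u v - π v) = 0 := by
    intro k
    induction k with
    | zero =>
      simp only [pow_zero, mul_sub, Finset.sum_sub_distrib]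
      rw [← Finset.sum_mul, ← hS, hπ]
      simp only [Matrix.one_apply, mul_ite, mul_one, mul_zero, Finset.sum_ite_eq',
        Finset.mem_univ, if_true]
      field_simp
      ring
    | succ k ih =>
      simp only [hstep, Finset.mul_sum]
      rw [Finset.sum_comm]
      rw [← ih]
      refine Finset.sum_congr rfl fun w _ => ?_
      simp only [← mul_assoc]
      rw [← Finset.sum_mul, hcol]
  have hmul : ∀ k : ℕ, ∀ u, Ptil.mulVec (fun w => Real.sqrt (d w) * ((P ^ k) w v - π v)) u
      = Real.sqrt (d u) * ((P ^ (k+1)) u v - π v) := by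
    intro k u
    rw [hstep, Finset.mul_sum]
    simp only [Matrix.mulVec, dotProduct]
    refine Finset.sum_congr rfl fun w _ => ?_
    rw [hPtil, hP]
    have h1 := (hsp u).ne'
    have h2 := (hsp w).ne'
    rw [← hss u]
    field_simp
    simp
  have hnorm : ∀ k : ℕ, Real.sqrt (∑ u, (Real.sqrt (d u) * ((P ^ k) u v - π v)) ^ 2)
      ≤ lam ^ k * Real.sqrt (d v) := by
    intro k
    induction k with
    | zero =>
      rw [pow_zero lam, one_mul]
      apply Real.sqrt_le_sqrt
      have h0 := horth 0
      have e : ∀ u, (Real.sqrt (d u) * ((P ^ 0) u v - π v)) ^ 2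
          = (if u = v then d u * (1 - π v) else 0) - π v * (d u * ((P ^ 0) u v - π v)) := by
        intro u
        rw [mul_pow, sq, hss]
        simp only [pow_zero, Matrix.one_apply]
        split_ifs <;> ring
      simp only [e]
      rw [Finset.sum_sub_distrib, ← Finset.mul_sum, h0]
      simp only [Finset.sum_ite_eq', Finset.mem_univ, if_true]
      nlinarith [hdpos v]
    | succ k ih =>
      have h := hgap (fun w => Real.sqrt (d w) * ((P ^ k) w v - π v)) (by
        rw [← horth k]
        refine Finset.sum_congr rfl fun w _ => ?_
        rw [← hss w]
        simp only [Real.sqrt_mul_self (hsp w).le]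
        ring)
      simp only [hmul] at h
      refine h.trans ?_
      rw [pow_succ', mul_assoc]
      exact mul_le_mul_of_nonneg_left ih hlam0
  have key : |(P ^ ℓ) u v - π v| ≤ lam ^ ℓ * Real.sqrt (d v) / Real.sqrt (d u) := by
    rw [le_div_iff₀ (hsp u)]
    refine le_trans ?_ (hnorm ℓ)
    apply Real.le_sqrt_of_sq_le
    have := Finset.single_le_sum (f := fun u => (Real.sqrt (d u) * ((P ^ ℓ) u v - π v)) ^ 2)
      (fun i _ => sq_nonneg _) (Finset.mem_univ u)
    refine le_trans (le_of_eq ?_) this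
    simp only [mul_pow, sq_abs]
    ring
  refine ⟨?_, key⟩
  rw [div_le_iff₀ hpv]
  refine key.trans (le_of_eq ?_)
  rw [hπ, Real.sqrt_mul (hdpos u).le]
  have h1 := (hsp u).ne'
  have h2 := (hsp v).ne'
  field_simp
  rw [sq, hss]
end

section
/- For all vertices u, v, the sequence ℓ ↦ (P ^ ℓ) u v converges to π v as ℓ → ∞: Filter.Tendsto (fun ℓ : ℕ => (P ^ ℓ) u v) Filter.atTop (nhds (π v)). -/
open Finset

theorem transition_power_tendsto_stationary
    {V : Type*} [Fintype V] [Nonempty V] [DecidableEq V]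
    (A : Matrix V V ℝ) (hsym : A.IsSymm) (hnn : ∀ u v, 0 ≤ A u v)
    (d : V → ℝ) (hd : ∀ u, d u = ∑ v, A u v) (hdpos : ∀ u, 0 < d u)
    (S : ℝ) (hS : S = ∑ u, d u)
    (P : Matrix V V ℝ) (hP : ∀ u v, P u v = A u v / d u)
    (Ptil : Matrix V V ℝ)
    (hPtil : ∀ u v, Ptil u v = A u v / (Real.sqrt (d u) * Real.sqrt (d v)))
    (π : V → ℝ) (hπ : ∀ v, π v = d v / S)
    (lam : ℝ) (hlam0 : 0 ≤ lam) (hlam1 : lam < 1)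
    (hgap : ∀ x : V → ℝ, (∑ v, x v * Real.sqrt (d v)) = 0 →
      Real.sqrt (∑ v, (Ptil.mulVec x v) ^ 2) ≤ lam * Real.sqrt (∑ v, (x v) ^ 2)) :
    ∀ u v : V, Filter.Tendsto (fun ℓ : ℕ => (P ^ ℓ) u v) Filter.atTop (nhds (π v)) := by
  intro u v
  have hsq : ∀ u, Real.sqrt (d u) * Real.sqrt (d u) = d u := fun u =>
    Real.mul_self_sqrt (hdpos u).le
  have hspos : ∀ u, 0 < Real.sqrt (d u) := fun u => Real.sqrt_pos.2 (hdpos u)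
  have hSpos : 0 < S := by
    rw [hS]
    exact Finset.sum_pos (fun u _ => hdpos u) Finset.univ_nonempty
  let f : ℕ → V → ℝ := fun l w => (P ^ l) w v - π v
  let y : ℕ → V → ℝ := fun l w => Real.sqrt (d w) * f l w
  have hf : ∀ l w, d w * f (l + 1) w = ∑ z, A w z * f l z := by
    intro l w
    have h1 : (P ^ (l + 1)) w v = ∑ z, P w z * (P ^ l) z v := by
      rw [pow_succ', Matrix.mul_apply]
    simp only [f]
    rw [h1, mul_sub, Finset.mul_sum]
    simp only [mul_sub, Finset.sum_sub_distrib]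
    rw [← Finset.sum_mul, ← hd w]
    congr 1
    refine Finset.sum_congr rfl fun z _ => ?_
    rw [hP, ← mul_assoc, mul_div_cancel₀ _ (hdpos w).ne']
  have hy : ∀ l, Ptil.mulVec (y l) = y (l + 1) := by
    intro l
    funext w
    have h2 : Real.sqrt (d w) * Ptil.mulVec (y l) w = Real.sqrt (d w) * y (l + 1) w := by
      simp only [y]
      rw [← mul_assoc, hsq, hf]
      simp only [Matrix.mulVec, dotProduct]
      rw [Finset.mul_sum]
      refine Finset.sum_congr rfl fun z _ => ?_
      rw [hPtil]
      have := (hspos w).ne'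
      have := (hspos z).ne'
      field_simp
    exact mul_left_cancel₀ (hspos w).ne' h2
  have hsum : ∀ l, ∑ w, d w * f l w = 0 := by
    intro l
    induction l with
    | zero =>
      simp only [f, pow_zero, mul_sub, Finset.sum_sub_distrib]
      rw [← Finset.sum_mul, ← hS, hπ, mul_div_cancel₀ _ hSpos.ne']
      simp [Matrix.one_apply]
    | succ l ih =>
      simp only [hf]
      rw [Finset.sum_comm, ← ih]
      refine Finset.sum_congr rfl fun z _ => ?_
      rw [← Finset.sum_mul, hd z]
      congr 1
      exact Finset.sum_congr rfl fun w _ => hsym.apply z w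
  have horth : ∀ l, ∑ w, y l w * Real.sqrt (d w) = 0 := by
    intro l
    rw [← hsum l]
    refine Finset.sum_congr rfl fun w _ => ?_
    simp only [y]
    rw [← hsq w, Real.sqrt_mul_self (Real.sqrt_nonneg _)]
    ring
  have hnorm : ∀ l, Real.sqrt (∑ w, (y l w) ^ 2) ≤ lam ^ l * Real.sqrt (∑ w, (y 0 w) ^ 2) := by
    intro l
    induction l with
    | zero => simp
    | succ l ih =>
      have h := hgap (y l) (horth l)
      rw [hy] at h
      calc _ ≤ _ := h
        _ ≤ lam * (lam ^ l * Real.sqrt (∑ w, (y 0 w) ^ 2)) := mul_le_mul_of_nonneg_left ih hlam0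
        _ = _ := by ring
  have habs : ∀ l, |y l u| ≤ lam ^ l * Real.sqrt (∑ w, (y 0 w) ^ 2) := by
    intro l
    refine le_trans ?_ (hnorm l)
    apply Real.abs_le_sqrt
    exact Finset.single_le_sum (f := fun w => (y l w) ^ 2) (fun w _ => sq_nonneg _)
      (Finset.mem_univ u)
  have hlim : Filter.Tendsto (fun l => y l u) Filter.atTop (nhds 0) := by
    refine squeeze_zero_norm (fun l => habs l) ?_
    simpa using (tendsto_pow_atTop_nhds_zero_of_lt_one hlam0 hlam1).mul_const
      (Real.sqrt (∑ w, (y 0 w) ^ 2))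
  have h3 := (hlim.const_mul (Real.sqrt (d u))⁻¹).add_const (π v)
  rw [mul_zero, zero_add] at h3
  refine h3.congr fun l => ?_
  simp only [y, f]
  rw [inv_mul_cancel_left₀ (hspos u).ne', sub_add_cancel]
end

section
/- Let (w i)_{i : V} be an orthonormal basis of EuclideanSpace ℝ V consisting of eigenvectors of Ptil, with Ptil.mulVec (w i) = μ i • w i for reals μ i. Then for all vertices u, v and every ℓ : ℕ, the spectral expansion (P ^ ℓ) u v = ∑ i, (μ i) ^ ℓ * (w i u / Real.sqrt (d u)) * (w i v * Real.sqrt (d v)) holds; i.e. (P ^ ℓ) u v = ∑ i, α i * β i * (μ i)^ℓ where α i = ⟨D^(−1/2) e_u, w i⟩ and β i = ⟨D^(1/2) e_v, w i⟩. -/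
open Finset

theorem transition_power_spectral_expansion
    {V : Type*} [Fintype V] [Nonempty V] [DecidableEq V]
    (A : Matrix V V ℝ) (hsym : A.IsSymm) (hnn : ∀ u v, 0 ≤ A u v)
    (d : V → ℝ) (hd : ∀ u, d u = ∑ v, A u v) (hdpos : ∀ u, 0 < d u)
    (P : Matrix V V ℝ) (hP : ∀ u v, P u v = A u v / d u)
    (Ptil : Matrix V V ℝ)
    (hPtil : ∀ u v, Ptil u v = A u v / (Real.sqrt (d u) * Real.sqrt (d v)))
    (w : OrthonormalBasis V ℝ (EuclideanSpace ℝ V)) (μ : V → ℝ)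
    (hw : ∀ i, Ptil.mulVec (w i) = μ i • (w i : V → ℝ)) :
    ∀ (u v : V) (ℓ : ℕ),
      (P ^ ℓ) u v =
        ∑ i, (μ i) ^ ℓ * (w i u / Real.sqrt (d u)) * (w i v * Real.sqrt (d v)) := by
  intro u v ℓ
  have hs : ∀ x, Real.sqrt (d x) ≠ 0 := fun x => (Real.sqrt_pos.mpr (hdpos x)).ne'
  induction ℓ generalizing u with
  | zero =>
    have h := w.sum_inner_mul_inner (EuclideanSpace.single u (1 : ℝ)) (EuclideanSpace.single v (1 : ℝ))
    simp only [EuclideanSpace.inner_single_left, EuclideanSpace.inner_single_right, map_one,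
      one_mul, conj_trivial, mul_one] at h
    have h2 : ∑ i, (μ i) ^ 0 * (w i u / Real.sqrt (d u)) * (w i v * Real.sqrt (d v))
        = (∑ i, w i u * w i v) * (Real.sqrt (d v) / Real.sqrt (d u)) := by
      rw [Finset.sum_mul]
      refine Finset.sum_congr rfl fun i _ => ?_
      ring
    rw [h2, h, pow_zero]
    by_cases huv : u = v
    · subst huv
      simp [hs u]
    · simp [Matrix.one_apply_ne huv, huv]
  | succ n ih =>
    rw [pow_succ', Matrix.mul_apply]
    simp_rw [ih, Finset.mul_sum]
    rw [Finset.sum_comm]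
    refine Finset.sum_congr rfl fun i _ => ?_
    have h := congrFun (hw i) u
    simp only [Matrix.mulVec, dotProduct, Pi.smul_apply, smul_eq_mul] at h
    have h3 : ∀ x, P u x * ((μ i) ^ n * (w i x / Real.sqrt (d x)) * (w i v * Real.sqrt (d v)))
        = (Ptil u x * w i x) * ((μ i) ^ n / Real.sqrt (d u) * (w i v * Real.sqrt (d v))) := by
      intro x
      have hu := Real.mul_self_sqrt (hdpos u).le
      have e : P u x = A u x / (Real.sqrt (d u) * Real.sqrt (d u)) := by rw [hP, hu]
      rw [e, hPtil]
      have h1 := hs u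
      have h2 := hs x
      field_simp
    simp_rw [h3]
    rw [← Finset.sum_mul, h]
    ring
end
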